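/- Let a, b, c : [0, L] → ℝ be continuous. Then there exists a 2×2 real matrix M = (m₁₁, m₁₂; m₂₁, m₂₂) with det M ≠ 0 such that every differentiable solution y : [0, L] → ℝ of the Riccati equation y' = a(x)y² + b(x)y + c(x) satisfies y(L)·(m₂₁ y(0) + m₂₂) = m₁₁ y(0) + m₁₂. (The time-L flow of a Riccati equation is a fractional-linear transformation; consequently the bicycle monodromy of a plane curve is a Möbius transformation.) -/

import Mathlib

lemma antideriv_aux (L : ℝ) (hL : 0 ≤ L) (f : ℝ → ℝ) (hf : ContinuousOn f (Set.Icc 0 L)) :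
    ∃ F : ℝ → ℝ, F 0 = 0 ∧ ∀ x ∈ Set.Icc (0:ℝ) L, HasDerivWithinAt F (f x) (Set.Icc 0 L) x := by
  have hg : Continuous (Set.IccExtend hL ((Set.Icc 0 L).domRestrict f)) :=
    (continuousOn_iff_continuous_domRestrict.1 hf).Icc_extend'
  refine ⟨fun x => ∫ t in (0:ℝ)..x, Set.IccExtend hL ((Set.Icc 0 L).domRestrict f) t, by simp, ?_⟩
  intro x hx
  have h := (hg.integral_hasStrictDerivAt 0 x).hasDerivAt.hasDerivWithinAt (s := Set.Icc 0 L)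
  rwa [Set.IccExtend_of_mem hL _ hx] at h

lemma lin_zero_aux (L : ℝ) (hL : 0 ≤ L) (g v : ℝ → ℝ) (hg : ContinuousOn g (Set.Icc 0 L))
    (hv : ∀ x ∈ Set.Icc (0:ℝ) L, HasDerivWithinAt v (g x * v x) (Set.Icc 0 L) x)
    (h0 : v 0 = 0) : v L = 0 := by
  obtain ⟨G, -, hG⟩ := antideriv_aux L hL g hg
  have hd : ∀ x ∈ Set.Icc (0:ℝ) L,
      HasDerivWithinAt (fun x => v x * Real.exp (-G x)) 0 (Set.Icc 0 L) x := by
    intro x hx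
    refine ((hv x hx).mul (hG x hx).neg.exp).congr_deriv ?_
    simp only [Pi.neg_apply]
    ring
  have := (convex_Icc (0:ℝ) L).norm_image_sub_le_of_norm_hasDerivWithin_le (C := 0) hd
    (by simp) (Set.left_mem_Icc.2 hL) (Set.right_mem_Icc.2 hL)
  have h2 : v L * Real.exp (-G L) = 0 := by
    have h3 := norm_le_zero_iff.1 (this.trans (by simp))
    simpa only [h0, zero_mul, sub_zero] using h3
  exact (mul_eq_zero.1 h2).resolve_right (Real.exp_ne_zero _)

/-- The time-`L` flow of a Riccati equation
`y' = a(x)y² + b(x)y + c(x)` is a fractional-linear (Möbius) transformation;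
consequently the bicycle monodromy of a plane curve is a Möbius transformation. -/
theorem riccati_flow_is_moebius (L : ℝ) (hL : 0 ≤ L) (a b c : ℝ → ℝ)
    (ha : ContinuousOn a (Set.Icc 0 L)) (hb : ContinuousOn b (Set.Icc 0 L))
    (hc : ContinuousOn c (Set.Icc 0 L)) :
    ∃ M : Matrix (Fin 2) (Fin 2) ℝ, M.det ≠ 0 ∧
      ∀ y : ℝ → ℝ,
        (∀ x ∈ Set.Icc (0:ℝ) L,
          HasDerivWithinAt y (a x * y x ^ 2 + b x * y x + c x) (Set.Icc 0 L) x) →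
        y L * (M 1 0 * y 0 + M 1 1) = M 0 0 * y 0 + M 0 1 := by
  by_cases hex : ∃ y : ℝ → ℝ, ∀ x ∈ Set.Icc (0:ℝ) L,
      HasDerivWithinAt y (a x * y x ^ 2 + b x * y x + c x) (Set.Icc 0 L) x
  swap
  · exact ⟨1, by simp, fun y hy => absurd ⟨y, hy⟩ hex⟩
  obtain ⟨z, hz⟩ := hex
  have hzc : ContinuousOn z (Set.Icc 0 L) := fun x hx => (hz x hx).continuousWithinAt
  obtain ⟨Q, hQ0, hQ⟩ := antideriv_aux L hL (fun x => 2 * a x * z x + b x) (by fun_prop)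
  have hQc : ContinuousOn Q (Set.Icc 0 L) := fun x hx => (hQ x hx).continuousWithinAt
  obtain ⟨P, hP0, hP⟩ := antideriv_aux L hL (fun x => a x * Real.exp (Q x)) (by fun_prop)
  refine ⟨!![Real.exp (Q L) - z L * P L,
    -Real.exp (Q L) * z 0 + z L + z L * P L * z 0; -P L, 1 + P L * z 0], ?_, ?_⟩
  · rw [Matrix.det_fin_two_of]
    convert Real.exp_ne_zero (Q L) using 1
    ring
  intro y hy
  have hyc : ContinuousOn y (Set.Icc 0 L) := fun x hx => (hy x hx).continuousWithinAt
  -- the quantity that vanishes identically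
  have key := lin_zero_aux L hL (fun x => a x * (y x - z x))
    (fun x => (y x - z x) * Real.exp (-Q x) * (1 - P x * (y 0 - z 0)) - (y 0 - z 0))
    (by fun_prop) (by
      intro x hx
      have h := ((((hy x hx).sub (hz x hx)).mul (hQ x hx).neg.exp).mul
        (((hP x hx).mul_const (y 0 - z 0)).const_sub 1)).sub_const (y 0 - z 0)
      refine h.congr_deriv ?_
      have he : Real.exp (Q x) * Real.exp (-Q x) = 1 := by
        rw [← Real.exp_add]; simp
      simp only [Pi.sub_apply, Pi.mul_apply, Pi.neg_apply]
      linear_combination -(a x * (y x - z x) * (y 0 - z 0)) * he) (by simp [hQ0, hP0])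
  have he : Real.exp (Q L) * Real.exp (-Q L) = 1 := by
    rw [← Real.exp_add]; simp
  simp at key ⊢
  linear_combination Real.exp (Q L) * key - (y L - z L) * (1 - P L * (y 0 - z 0)) * he
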